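/- (Theorem 3.3, symplectic Runge–Kutta mass conservation.) Let s ≥ 1 and let a : Fin s → Fin s → ℝ, b : Fin s → ℝ satisfy the symplecticity condition b_i·a_{i,j} + b_j·a_{j,i} = b_i·b_j for all i, j. Let τ ∈ ℝ, let u⁰ : Fin N → ℝ, and let the stage values U_i : Fin N → ℝ (for i ∈ Fin s) satisfy, in Fin N → ℂ, U_i = u⁰ + τ·Σ_j a_{i,j}·f_M(U_j), where f_M(w) := B_{HS2}w − (1/(m+1))·(w^{∘(m−1)} ⊙ (B_{S1}w) + B_{S1}(w^{∘m})). Define u¹ := u⁰ + τ·Σ_i b_i·f_M(U_i) ∈ (Fin N → ℂ). Then the discrete mass is conserved exactly: ⟨u¹, u¹⟩_h = ⟨u⁰, u⁰⟩_h. -/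

import Mathlib

open Matrix Complex BigOperators

noncomputable section

/-- The shifted integer index `k̂ = k - N/2` associated to `k ∈ Fin N`. -/
def khat (N : ℕ) (k : Fin N) : ℤ := (k : ℤ) - (N : ℤ) / 2

/-- The collocation angles `θ_j = 2π ĵ / N`. -/
def theta (N : ℕ) (j : Fin N) : ℝ := 2 * Real.pi * (khat N j : ℝ) / N

/-- The discrete Fourier matrix `F`, `F_{k,j} = (1/N) exp(-i k̂ θ_j)`. -/
def Fm (N : ℕ) : Matrix (Fin N) (Fin N) ℂ :=
  Matrix.of fun k j => (N : ℂ)⁻¹ * Complex.exp (-Complex.I * (khat N k : ℂ) * (theta N j : ℂ))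

/-- The inverse discrete Fourier matrix `G`, `G_{j,k} = exp(i k̂ θ_j)`. -/
def Gm (N : ℕ) : Matrix (Fin N) (Fin N) ℂ :=
  Matrix.of fun j k => Complex.exp (Complex.I * (khat N k : ℂ) * (theta N j : ℂ))

/-- The diagonal weight matrix `P = diag(α - i x_j)`. -/
def Pm (N : ℕ) (α : ℝ) (x : Fin N → ℝ) : Matrix (Fin N) (Fin N) ℂ :=
  Matrix.diagonal fun j => (α : ℂ) - Complex.I * (x j : ℂ)

/-- The diagonal matrix `P⁻¹ = diag((α - i x_j)⁻¹)`. -/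
def PinvM (N : ℕ) (α : ℝ) (x : Fin N → ℝ) : Matrix (Fin N) (Fin N) ℂ :=
  Matrix.diagonal fun j => ((α : ℂ) - Complex.I * (x j : ℂ))⁻¹

/-- The diagonal matrix `P̄ = diag(α + i x_j)`. -/
def PbarM (N : ℕ) (α : ℝ) (x : Fin N → ℝ) : Matrix (Fin N) (Fin N) ℂ :=
  Matrix.diagonal fun j => (α : ℂ) + Complex.I * (x j : ℂ)

/-- The discrete Hilbert transform matrix `H = diag(-i sgn(k̂))` with `sgn(0) = 1`. -/
def Hm (N : ℕ) : Matrix (Fin N) (Fin N) ℂ :=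
  Matrix.diagonal fun k => if 0 ≤ khat N k then -Complex.I else Complex.I

/-- The tridiagonal differentiation matrix `S1`:
`(S1)_{k,k-1} = i k̂/(2α)`, `(S1)_{k,k} = i (2k̂+1)/(2α)`, `(S1)_{k,k+1} = i (k̂+1)/(2α)`. -/
def S1 (N : ℕ) (α : ℝ) : Matrix (Fin N) (Fin N) ℂ :=
  Matrix.of fun k l =>
    if (l : ℤ) = (k : ℤ) - 1 then Complex.I * (khat N k : ℂ) / (2 * (α : ℂ))
    else if (l : ℤ) = (k : ℤ) then Complex.I * (2 * (khat N k : ℂ) + 1) / (2 * (α : ℂ))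
    else if (l : ℤ) = (k : ℤ) + 1 then Complex.I * ((khat N k : ℂ) + 1) / (2 * (α : ℂ))
    else 0

/-- The second-derivative matrix `S2 = S1 · S1`. -/
def S2 (N : ℕ) (α : ℝ) : Matrix (Fin N) (Fin N) ℂ := S1 N α * S1 N α

/-- The discrete inner product `⟨u,v⟩_h = (π/(Nα)) Σ_j (α² + x_j²) u_j conj(v_j)`. -/
def iph (N : ℕ) (α : ℝ) (x : Fin N → ℝ) (u v : Fin N → ℂ) : ℂ :=
  ((Real.pi / (N * α) : ℝ) : ℂ) *
    ∑ j, ((α ^ 2 + x j ^ 2 : ℝ) : ℂ) * u j * (starRingEnd ℂ) (v j)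

/-- The conjugated first-derivative operator `B_{S1} = P⁻¹ G S1 F P`. -/
def BS1 (N : ℕ) (α : ℝ) (x : Fin N → ℝ) : Matrix (Fin N) (Fin N) ℂ :=
  PinvM N α x * Gm N * S1 N α * Fm N * Pm N α x

/-- The conjugated operator `B_{HS1} = P⁻¹ G H S1 F P`. -/
def BHS1 (N : ℕ) (α : ℝ) (x : Fin N → ℝ) : Matrix (Fin N) (Fin N) ℂ :=
  PinvM N α x * Gm N * Hm N * S1 N α * Fm N * Pm N α x

/-- The conjugated dispersion operator `B_{HS2} = P⁻¹ G H S2 F P`. -/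
def BHS2 (N : ℕ) (α : ℝ) (x : Fin N → ℝ) : Matrix (Fin N) (Fin N) ℂ :=
  PinvM N α x * Gm N * Hm N * S2 N α * Fm N * Pm N α x

/-- Coercion of a real vector into a complex vector. -/
def cv (N : ℕ) (u : Fin N → ℝ) : Fin N → ℂ := fun j => (u j : ℂ)

/-- Entrywise `m`-th power of a complex vector. -/
def pw (N : ℕ) (m : ℕ) (u : Fin N → ℂ) : Fin N → ℂ := fun j => u j ^ m

/-- The mass-conservative semi-discrete right-hand side
`f_M(w) = B_{HS2} w - (1/(m+1)) (w^{∘(m-1)} ⊙ (B_{S1} w) + B_{S1}(w^{∘m}))`. -/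
def fM (N : ℕ) (α : ℝ) (x : Fin N → ℝ) (m : ℕ) (w : Fin N → ℂ) : Fin N → ℂ :=
  fun j => (BHS2 N α x *ᵥ w) j
    - (1 / ((m : ℂ) + 1)) *
        ((w j) ^ (m - 1) * (BS1 N α x *ᵥ w) j + (BS1 N α x *ᵥ pw N m w) j)

/-- The energy-conservative semi-discrete right-hand side
`f_E(w) = -B_{S1}(-B_{HS1} w + (1/m) w^{∘m})`. -/
def fE (N : ℕ) (α : ℝ) (x : Fin N → ℝ) (m : ℕ) (w : Fin N → ℂ) : Fin N → ℂ :=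
  -(BS1 N α x *ᵥ (-(BHS1 N α x *ᵥ w) + (1 / (m : ℂ)) • pw N m w))

/-- The semi-discrete energy
`E_h(w) = (1/2)⟨B_{HS1} w, w⟩_h - (1/(m(m+1)))⟨w^{∘m}, w⟩_h`. -/
def Eh (N : ℕ) (α : ℝ) (x : Fin N → ℝ) (m : ℕ) (w : Fin N → ℂ) : ℂ :=
  (1 / 2 : ℂ) * iph N α x (BHS1 N α x *ᵥ w) w
    - (1 / ((m : ℂ) * ((m : ℂ) + 1))) * iph N α x (pw N m w) w

end

/-- A Runge–Kutta method whose coefficients satisfy `bᵢ aᵢⱼ + bⱼ aⱼᵢ = bᵢ bⱼ` preserves every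
sesquilinear form that is stationary along the vector field at the stages. -/
theorem symplectic_rungeKutta_form_eq {V : Type*} [AddCommGroup V] [Module ℂ V]
    (B : V →ₗ[ℂ] V →ₗ⋆[ℂ] ℂ) {ι : Type*} [Fintype ι] (a : ι → ι → ℝ) (b : ι → ℝ)
    (hab : ∀ i j, b i * a i j + b j * a j i = b i * b j) (τ : ℝ) (u : V) (U f : ι → V)
    (hU : ∀ i, U i = u + (τ : ℂ) • ∑ j, (a i j : ℂ) • f j)
    (hf : ∀ i, B (f i) (U i) + B (U i) (f i) = 0) :
    B (u + (τ : ℂ) • ∑ i, (b i : ℂ) • f i) (u + (τ : ℂ) • ∑ i, (b i : ℂ) • f i) = B u u := by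
  have hstat : ∀ i, B (f i) u + B u (f i) =
      -(τ * ∑ j, (a i j : ℂ) * B (f i) (f j)) - τ * ∑ j, (a i j : ℂ) * B (f j) (f i) := by
    intro i
    have h := hf i
    rw [hU i] at h
    simp only [map_add, map_sum, map_smulₛₗ, LinearMap.add_apply, LinearMap.smul_apply,
      LinearMap.sum_apply, smul_eq_mul, Complex.conj_ofReal, RingHom.id_apply] at h
    linear_combination h
  have hsum : ∑ i, (b i : ℂ) * (B (f i) u + B u (f i)) =
      -(τ * ∑ i, ∑ j, (b i : ℂ) * b j * B (f i) (f j)) := by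
    have hswap : ∑ i, ∑ j, (b i : ℂ) * a i j * B (f j) (f i) =
        ∑ i, ∑ j, (b j : ℂ) * a j i * B (f i) (f j) := Finset.sum_comm
    have hsplit : ∑ i, ∑ j, (b i : ℂ) * b j * B (f i) (f j) =
        ∑ i, ∑ j, (b i : ℂ) * a i j * B (f i) (f j)
          + ∑ i, ∑ j, (b i : ℂ) * a i j * B (f j) (f i) := by
      rw [hswap, ← Finset.sum_add_distrib]
      refine Finset.sum_congr rfl fun i _ => ?_
      rw [← Finset.sum_add_distrib]
      refine Finset.sum_congr rfl fun j _ => ?_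
      have h : (b i : ℂ) * a i j + b j * a j i = b i * b j := by exact_mod_cast hab i j
      rw [← h]
      ring
    rw [hsplit, mul_add, Finset.mul_sum, Finset.mul_sum, neg_add, ← Finset.sum_neg_distrib,
      ← Finset.sum_neg_distrib, ← Finset.sum_add_distrib]
    refine Finset.sum_congr rfl fun i _ => ?_
    simp only [hstat, mul_assoc, ← Finset.mul_sum]
    ring
  simp only [map_add, map_sum, map_smulₛₗ, LinearMap.add_apply, LinearMap.smul_apply,
    LinearMap.sum_apply, smul_eq_mul, Complex.conj_ofReal, RingHom.id_apply]
  have hquad : ∑ i, (b i : ℂ) * (τ * ∑ j, (b j : ℂ) * B (f j) (f i)) =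
      τ * ∑ i, ∑ j, (b i : ℂ) * b j * B (f i) (f j) := by
    simp only [Finset.mul_sum]
    rw [Finset.sum_comm]
    refine Finset.sum_congr rfl fun i _ => Finset.sum_congr rfl fun j _ => ?_
    ring
  have hlin := hsum
  simp only [mul_add, Finset.sum_add_distrib] at hlin ⊢
  rw [hquad]
  linear_combination (τ : ℂ) * hlin

/-- The discrete inner product as a sesquilinear form. -/
noncomputable def iphForm (N : ℕ) (α : ℝ) (x : Fin N → ℝ) : (Fin N → ℂ) →ₗ[ℂ] (Fin N → ℂ) →ₗ⋆[ℂ] ℂ :=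
  LinearMap.mk₂'ₛₗ (RingHom.id ℂ) (starRingEnd ℂ) (iph N α x)
    (fun u u' v => by
      simp only [iph, Pi.add_apply, ← mul_add, ← Finset.sum_add_distrib]
      congr 1
      exact Finset.sum_congr rfl fun j _ => by ring)
    (fun c u v => by
      simp only [iph, Pi.smul_apply, smul_eq_mul, Finset.mul_sum, RingHom.id_apply]
      exact Finset.sum_congr rfl fun j _ => by ring)
    (fun u v v' => by
      simp only [iph, Pi.add_apply, map_add, ← mul_add, ← Finset.sum_add_distrib])
    (fun c u v => by
      simp only [iph, Pi.smul_apply, smul_eq_mul, map_mul, Finset.mul_sum]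
      exact Finset.sum_congr rfl fun j _ => by ring)

theorem iphForm_apply (N : ℕ) (α : ℝ) (x : Fin N → ℝ) (u v : Fin N → ℂ) :
    iphForm N α x u v = iph N α x u v := rfl

theorem iph_eq_dotProduct (N : ℕ) (α : ℝ) (x : Fin N → ℝ) (u v : Fin N → ℂ) :
    iph N α x u v = ((Real.pi / (N * α) : ℝ) : ℂ) *
      (star (Pm N α x *ᵥ v) ⬝ᵥ (Pm N α x *ᵥ u)) := by
  simp only [iph, dotProduct, Pm, mulVec_diagonal, Pi.star_apply]
  congr 1
  refine Finset.sum_congr rfl fun j _ => ?_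
  simp only [star_def, map_mul, map_sub, conj_ofReal, conj_I]
  push_cast
  linear_combination ((x j : ℂ) ^ 2 * u j * (starRingEnd ℂ) (v j)) * I_sq

theorem Pm_mul_PinvM (N : ℕ) {α : ℝ} (hα : 0 < α) (x : Fin N → ℝ) :
    Pm N α x * PinvM N α x = 1 := by
  rw [Pm, PinvM, diagonal_mul_diagonal, ← diagonal_one]
  congr 1
  funext j
  refine mul_inv_cancel₀ fun h => hα.ne' ?_
  simpa using congrArg Complex.re h

theorem Gm_eq_smul_conjTranspose (N : ℕ) (hN0 : 0 < N) : Gm N = (N : ℂ) • (Fm N)ᴴ := by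
  ext j k
  have hN : (N : ℂ) ≠ 0 := by exact_mod_cast hN0.ne'
  simp only [Gm, Fm, of_apply, Matrix.smul_apply, conjTranspose_apply, smul_eq_mul, star_def, map_mul,
    map_inv₀, map_natCast, ← Complex.exp_conj, map_neg, conj_I, conj_ofReal, map_intCast, neg_neg]
  rw [mul_inv_cancel_left₀ hN]

/-- Conjugating a skew-Hermitian matrix by the weighted discrete Fourier transform gives an
operator that is skew-adjoint for the discrete inner product. -/
theorem iph_skew_of_conjTranspose_eq_neg {N : ℕ} (hN0 : 0 < N) {α : ℝ} (hα : 0 < α)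
    (x : Fin N → ℝ) {M : Matrix (Fin N) (Fin N) ℂ} (hM : Mᴴ = -M) (u v : Fin N → ℂ) :
    iph N α x ((PinvM N α x * Gm N * M * Fm N * Pm N α x) *ᵥ u) v =
      -iph N α x u ((PinvM N α x * Gm N * M * Fm N * Pm N α x) *ᵥ v) := by
  set K := Gm N * M * Fm N with hK
  have hKskew : Kᴴ = -K := by
    rw [hK, Gm_eq_smul_conjTranspose N hN0]
    simp [conjTranspose_mul, hM, Matrix.mul_assoc]
  have hP : ∀ w : Fin N → ℂ,
      Pm N α x *ᵥ ((PinvM N α x * Gm N * M * Fm N * Pm N α x) *ᵥ w) =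
        K *ᵥ (Pm N α x *ᵥ w) := by
    intro w
    rw [mulVec_mulVec, mulVec_mulVec]
    congr 1
    simp only [hK, ← Matrix.mul_assoc, Pm_mul_PinvM N hα x, Matrix.one_mul]
  rw [iph_eq_dotProduct, iph_eq_dotProduct, hP, hP, star_mulVec K, hKskew, ← dotProduct_mulVec,
    neg_mulVec, dotProduct_neg, mul_neg, neg_neg]

theorem S1_conjTranspose (N : ℕ) (α : ℝ) : (S1 N α)ᴴ = -S1 N α := by
  ext k l
  rw [conjTranspose_apply, Matrix.neg_apply]
  simp only [S1, of_apply]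
  by_cases hlow : (l : ℤ) = k - 1
  · have hk : khat N k = khat N l + 1 := by simp only [khat]; omega
    rw [if_neg (by omega), if_neg (by omega), if_pos (by omega), if_pos hlow, hk]
    simp [neg_div]
  by_cases hdiag : (l : ℤ) = k
  · obtain rfl : l = k := Fin.ext (by omega)
    rw [if_neg hlow, if_pos hdiag]
    simp [neg_div]
  by_cases hupp : (l : ℤ) = k + 1
  · have hl : khat N l = khat N k + 1 := by simp only [khat]; omega
    rw [if_pos (by omega), if_neg hlow, if_neg hdiag, if_pos hupp, hl]
    simp [neg_div]
  · rw [if_neg (by omega), if_neg (by omega), if_neg (by omega), if_neg hlow, if_neg hdiag,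
      if_neg hupp]
    simp

theorem Hm_mul_S1_comm (N : ℕ) (α : ℝ) : Hm N * S1 N α = S1 N α * Hm N := by
  ext k l
  rw [Hm, diagonal_mul, mul_diagonal, mul_comm]
  by_cases hsgn : 0 ≤ khat N k ↔ 0 ≤ khat N l
  · simp only [hsgn]
  · suffices h : S1 N α k l = 0 by rw [h, zero_mul, zero_mul]
    simp only [S1, of_apply]
    split_ifs with h₁ h₂ h₃
    · have h : khat N k = 0 := by simp only [khat] at *; omega
      simp [h]
    · exact absurd (by simp only [khat, h₂]) hsgn
    · have h : khat N k = -1 := by simp only [khat] at *; omega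
      simp [h]
    · rfl

theorem Hm_mul_S2_conjTranspose (N : ℕ) (α : ℝ) : (Hm N * S2 N α)ᴴ = -(Hm N * S2 N α) := by
  have hH : (Hm N)ᴴ = -Hm N := by
    rw [Hm, diagonal_conjTranspose, Matrix.diagonal_neg]
    congr 1
    funext k
    simp only [Pi.star_apply]
    split_ifs <;> simp
  have hcomm : S2 N α * Hm N = Hm N * S2 N α := by
    rw [S2, Matrix.mul_assoc, ← Hm_mul_S1_comm, ← Matrix.mul_assoc, ← Hm_mul_S1_comm,
      Matrix.mul_assoc]
  rw [conjTranspose_mul, hH, Matrix.mul_neg]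
  nth_rewrite 1 [S2]
  rw [conjTranspose_mul, S1_conjTranspose, neg_mul_neg, ← S2, hcomm]

theorem iph_conj_symm (N : ℕ) (α : ℝ) (x : Fin N → ℝ) (u v : Fin N → ℂ) :
    (starRingEnd ℂ) (iph N α x u v) = iph N α x v u := by
  simp only [iph, map_mul, map_sum, conj_ofReal, conj_conj]
  congr 1
  exact Finset.sum_congr rfl fun j _ => by ring

/-- The real part of `⟨f_M(w), w⟩_h` vanishes for real `w`. -/
theorem iph_fM_add_iph_fM {N : ℕ} (hN0 : 0 < N) {α : ℝ} (hα : 0 < α) (x : Fin N → ℝ)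
    {m : ℕ} (hm : 1 ≤ m) (u : Fin N → ℝ) :
    iph N α x (fM N α x m (cv N u)) (cv N u) + iph N α x (cv N u) (fM N α x m (cv N u)) = 0 := by
  set w := cv N u with hw
  have hH : ∀ v v', iph N α x (BHS2 N α x *ᵥ v) v' = -iph N α x v (BHS2 N α x *ᵥ v') := by
    simpa only [BHS2, Matrix.mul_assoc] using
      iph_skew_of_conjTranspose_eq_neg hN0 hα x (Hm_mul_S2_conjTranspose N α)
  have hS : ∀ v v', iph N α x (BS1 N α x *ᵥ v) v' = -iph N α x v (BS1 N α x *ᵥ v') :=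
    iph_skew_of_conjTranspose_eq_neg hN0 hα x (S1_conjTranspose N α)
  set g : Fin N → ℂ := fun j => w j ^ (m - 1) * (BS1 N α x *ᵥ w) j with hg
  have hfM : fM N α x m w =
      BHS2 N α x *ᵥ w - ((1 / ((m : ℝ) + 1) : ℝ) : ℂ) • (g + BS1 N α x *ᵥ pw N m w) := by
    funext j
    simp [fM, hg, mul_add]
  have hgw : iph N α x g w = iph N α x (BS1 N α x *ᵥ w) (pw N m w) := by
    simp only [iph]
    congr 1
    refine Finset.sum_congr rfl fun j _ => ?_
    obtain ⟨n, rfl⟩ : ∃ n, m = n + 1 := ⟨m - 1, by omega⟩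
    simp only [hg, hw, cv, pw, map_pow, conj_ofReal, Nat.add_sub_cancel]
    ring
  have hwg : iph N α x w g = iph N α x (pw N m w) (BS1 N α x *ᵥ w) := by
    rw [← iph_conj_symm, hgw, iph_conj_symm]
  rw [hfM]
  simp only [← iphForm_apply, map_sub, map_add, map_smulₛₗ, LinearMap.sub_apply,
    LinearMap.add_apply, LinearMap.smul_apply, smul_eq_mul, conj_ofReal, RingHom.id_apply]
  simp only [iphForm_apply, hgw, hwg, hH, hS]
  ring

/-- Theorem 3.3 (symplectic Runge–Kutta mass conservation): if the Runge–Kutta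
coefficients satisfy `bᵢ aᵢⱼ + bⱼ aⱼᵢ = bᵢ bⱼ` and the real stage values satisfy
`Uᵢ = u⁰ + τ Σⱼ aᵢⱼ f_M(Uⱼ)`, then the update `u¹ = u⁰ + τ Σᵢ bᵢ f_M(Uᵢ)`
conserves the discrete mass exactly. -/
theorem srk_mass_conservation (N : ℕ) (hN : Even N) (hN0 : 0 < N)
    (α : ℝ) (hα : 0 < α) (x : Fin N → ℝ) (m : ℕ) (hm : 1 ≤ m)
    (s : ℕ) (hs : 1 ≤ s) (a : Fin s → Fin s → ℝ) (b : Fin s → ℝ)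
    (hab : ∀ i j, b i * a i j + b j * a j i = b i * b j)
    (τ : ℝ) (u0 : Fin N → ℝ) (U : Fin s → Fin N → ℝ)
    (hstage : ∀ i, cv N (U i)
      = cv N u0 + (τ : ℂ) • ∑ j, (a i j : ℂ) • fM N α x m (cv N (U j))) :
    iph N α x (cv N u0 + (τ : ℂ) • ∑ i, (b i : ℂ) • fM N α x m (cv N (U i)))
        (cv N u0 + (τ : ℂ) • ∑ i, (b i : ℂ) • fM N α x m (cv N (U i)))
      = iph N α x (cv N u0) (cv N u0) := by
  exact symplectic_rungeKutta_form_eq (iphForm N α x) a b hab τ (cv N u0) (fun i => cv N (U i))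
    (fun i => fM N α x m (cv N (U i))) hstage fun i => iph_fM_add_iph_fM hN0 hα x hm (U i)
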